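/- For every finite simple graph G that can be transformed into a linear forest by vertex splits, the minimum number of exclusive vertex splits required to transform G into a linear forest equals the minimum number of inclusive vertex splits required to transform G into a linear forest. -/

import Mathlib

open SimpleGraph

/-- Inclusive vertex split of the vertex `u` of `G`.  The resulting graph `G'` lives on
vertex set `Option V`, where `some u` plays the role of the first copy `v₁` of `u` and
`none` plays the role of the second copy `v₂`; every other vertex `x` is represented by
`some x`, with all adjacencies among such vertices unchanged.  The neighborhoods of the
two copies are contained in `N(u)` and their union is `N(u)`; the two copies are not
adjacent to each other. -/
def IsInclusiveSplit {V : Type} (G : SimpleGraph V) (G' : SimpleGraph (Option V))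
    (u : V) : Prop :=
  (∀ x y : V, x ≠ u → y ≠ u → (G'.Adj (some x) (some y) ↔ G.Adj x y)) ∧
  (¬ G'.Adj (some u) none) ∧
  (∀ x : V, G'.Adj (some u) (some x) → G.Adj u x) ∧
  (∀ x : V, G'.Adj none (some x) → G.Adj u x) ∧
  (∀ x : V, G.Adj u x → (G'.Adj (some u) (some x) ∨ G'.Adj none (some x)))

/-- Exclusive vertex split: an inclusive split in which the neighborhoods of the two
copies are disjoint (they partition `N(u)`). -/
def IsExclusiveSplit {V : Type} (G : SimpleGraph V) (G' : SimpleGraph (Option V))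
    (u : V) : Prop :=
  IsInclusiveSplit G G' u ∧
  ∀ x : V, ¬ (G'.Adj (some u) (some x) ∧ G'.Adj none (some x))

/-- `InclReach P k V G` : the graph `G` can be transformed, by a sequence of **at most**
`k` inclusive vertex splits, into a graph satisfying the property `P`. -/
def InclReach (P : (W : Type) → SimpleGraph W → Prop) :
    (k : ℕ) → (V : Type) → SimpleGraph V → Prop
  | 0, V, G => P V G
  | k+1, V, G => P V G ∨ ∃ (u : V) (G' : SimpleGraph (Option V)),
      IsInclusiveSplit G G' u ∧ InclReach P k (Option V) G'

/-- `ExclReach P k V G` : the graph `G` can be transformed, by a sequence of **at most**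
`k` exclusive vertex splits, into a graph satisfying the property `P`. -/
def ExclReach (P : (W : Type) → SimpleGraph W → Prop) :
    (k : ℕ) → (V : Type) → SimpleGraph V → Prop
  | 0, V, G => P V G
  | k+1, V, G => P V G ∨ ∃ (u : V) (G' : SimpleGraph (Option V)),
      IsExclusiveSplit G G' u ∧ ExclReach P k (Option V) G'

/-- The vertex type obtained from `V` after `k` vertex splits. -/
def IterOpt : ℕ → Type → Type
  | 0, V => V
  | k+1, V => IterOpt k (Option V)

/-- `InclSeq k V G G'` : `G'` is obtained from `G` by a sequence of **exactly** `k`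
inclusive vertex splits. -/
def InclSeq : (k : ℕ) → (V : Type) → SimpleGraph V → SimpleGraph (IterOpt k V) → Prop
  | 0, _V, G, G' => G' = G
  | k+1, V, G, G' => ∃ (u : V) (G₁ : SimpleGraph (Option V)),
      IsInclusiveSplit G G₁ u ∧ InclSeq k (Option V) G₁ G'

/-- `ExclSeq k V G G'` : `G'` is obtained from `G` by a sequence of **exactly** `k`
exclusive vertex splits. -/
def ExclSeq : (k : ℕ) → (V : Type) → SimpleGraph V → SimpleGraph (IterOpt k V) → Prop
  | 0, _V, G, G' => G' = G
  | k+1, V, G, G' => ∃ (u : V) (G₁ : SimpleGraph (Option V)),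
      IsExclusiveSplit G G₁ u ∧ ExclSeq k (Option V) G₁ G'

/-- A (single) cycle: a connected graph in which every vertex has degree exactly 2. -/
def IsSingleCycle {W : Type} (G : SimpleGraph W) : Prop :=
  G.Connected ∧ ∀ v : W, (G.neighborSet v).ncard = 2

/-- A cycle graph: a disjoint union of cycles, i.e. every connected component is a cycle. -/
def IsCycleGraph {W : Type} (G : SimpleGraph W) : Prop :=
  ∀ C : G.ConnectedComponent, IsSingleCycle (G.induce C.supp)

/-- A star: a single central vertex adjacent to all other vertices, with no other edges. -/
def IsStarGraph {W : Type} (G : SimpleGraph W) : Prop :=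
  ∃ c : W, ∀ v w : W, G.Adj v w ↔ ((v = c ∧ w ≠ c) ∨ (w = c ∧ v ≠ c))

/-- A constellation: a disjoint union of stars, i.e. every connected component is a star. -/
def IsConstellation {W : Type} (G : SimpleGraph W) : Prop :=
  ∀ C : G.ConnectedComponent, IsStarGraph (G.induce C.supp)

/-- A linear forest: every connected component is a path with at least one edge.
Equivalently (for finite graphs): acyclic, maximum degree at most 2,
and no isolated vertices. -/
def IsLinearForest {W : Type} (G : SimpleGraph W) : Prop :=
  G.IsAcyclic ∧ (∀ v : W, (G.neighborSet v).ncard ≤ 2) ∧ (∀ v : W, ∃ w, G.Adj v w)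

/-- The weight of a set of subgraphs: the sum of the numbers of vertices of its members. -/
noncomputable def wgt {V : Type} {G : SimpleGraph V} (P : Finset G.Subgraph) : ℕ :=
  ∑ H ∈ P, H.verts.ncard

/-- The edge sets of the members of `P` form a partition of the edge set of `G`:
every edge of `G` lies in exactly one member of `P`. -/
def IsEdgeDecomposition {V : Type} {G : SimpleGraph V} (P : Finset G.Subgraph) : Prop :=
  ∀ e ∈ G.edgeSet, ∃! H : G.Subgraph, H ∈ P ∧ e ∈ H.edgeSet

/-- A star decomposition of `G`: a set of subgraphs of `G`, each of which is a star
(with a nonempty edge set, as parts of a partition are nonempty), whose edge sets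
partition `E(G)`. -/
def IsStarDecomposition {V : Type} {G : SimpleGraph V} (P : Finset G.Subgraph) : Prop :=
  (∀ H ∈ P, H.edgeSet.Nonempty ∧ IsStarGraph H.coe) ∧ IsEdgeDecomposition P

/-- A `Γ`-decomposition of `G`, where `Γ` is a family of graphs: a set of subgraphs of
`G`, each isomorphic to a member of `Γ` (with a nonempty edge set, as parts of a
partition are nonempty), whose edge sets partition `E(G)`. -/
def IsGammaDecomposition {V ι : Type} (Γ : ι → (W : Type) × SimpleGraph W)
    {G : SimpleGraph V} (P : Finset G.Subgraph) : Prop :=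
  (∀ H ∈ P, H.edgeSet.Nonempty ∧ ∃ i : ι, Nonempty (H.coe ≃g (Γ i).2)) ∧
  IsEdgeDecomposition P

/-- `G` is a disjoint union of graphs of the family `Γ`: every connected component of
`G` is isomorphic to a member of `Γ`. -/
def IsDisjointUnionOf {V ι : Type} (Γ : ι → (W : Type) × SimpleGraph W)
    (G : SimpleGraph V) : Prop :=
  ∀ C : G.ConnectedComponent, ∃ i : ι, Nonempty ((G.induce C.supp) ≃g (Γ i).2)

/-- A vertex map `f` that is a surjective homomorphism from `H` to `G`, on vertices and on edges. -/
structure IsFolding {W V : Type} (H : SimpleGraph W) (G : SimpleGraph V) (f : W → V) : Prop where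
  surjective : Function.Surjective f
  map_adj : ∀ {a b}, H.Adj a b → G.Adj (f a) (f b)
  exists_adj : ∀ {x y}, G.Adj x y → ∃ a b, H.Adj a b ∧ f a = x ∧ f b = y

theorem IsFolding.id {V : Type} (G : SimpleGraph V) : IsFolding G G id :=
  ⟨Function.surjective_id, fun h => h, fun h => ⟨_, _, h, rfl, rfl⟩⟩

theorem IsFolding.comp {U W V : Type} {K : SimpleGraph U} {H : SimpleGraph W}
    {G : SimpleGraph V} {f : W → V} {g : U → W} (hf : IsFolding H G f) (hg : IsFolding K H g) :
    IsFolding K G (f ∘ g) where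
  surjective := hf.surjective.comp hg.surjective
  map_adj h := hf.map_adj (hg.map_adj h)
  exists_adj h := by
    obtain ⟨a, b, hab, rfl, rfl⟩ := hf.exists_adj h
    obtain ⟨c, d, hcd, rfl, rfl⟩ := hg.exists_adj hab
    exact ⟨c, d, hcd, rfl, rfl⟩

theorem IsInclusiveSplit.isFolding {V : Type} {G : SimpleGraph V} {G' : SimpleGraph (Option V)}
    {u : V} (h : IsInclusiveSplit G G' u) : IsFolding G' G (fun o => o.getD u) := by
  obtain ⟨h_off, h_copies, h_fst, h_snd, h_cover⟩ := h
  have h_from : ∀ {y}, G.Adj u y → ∃ a b : Option V,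
      G'.Adj a b ∧ a.getD u = u ∧ b.getD u = y := by
    intro y hy
    rcases h_cover y hy with h | h
    · exact ⟨_, _, h, rfl, rfl⟩
    · exact ⟨_, _, h, rfl, rfl⟩
  refine ⟨fun x => ⟨some x, rfl⟩, ?_, ?_⟩
  · rintro (_ | a) (_ | b) hab
    · exact (G'.irrefl hab).elim
    · exact h_snd b hab
    · exact (h_snd a hab.symm).symm
    · by_cases ha : a = u
      · subst ha
        exact h_fst b hab
      by_cases hb : b = u
      · subst hb
        exact (h_fst a hab.symm).symm
      exact (h_off a b ha hb).1 hab
  · intro x y hxy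
    by_cases hx : x = u
    · subst hx
      exact h_from hxy
    by_cases hy : y = u
    · subst hy
      obtain ⟨a, b, hab, ha, hb⟩ := h_from hxy.symm
      exact ⟨b, a, hab.symm, hb, ha⟩
    exact ⟨some x, some y, (h_off x y hx hy).2 hxy, rfl, rfl⟩

theorem InclReach.exists_isFolding {P : (W : Type) → SimpleGraph W → Prop} {k : ℕ} {V : Type}
    [Fintype V] {G : SimpleGraph V} (h : InclReach P k V G) :
    ∃ (W : Type) (_ : Fintype W) (H : SimpleGraph W) (f : W → V),
      P W H ∧ IsFolding H G f ∧ Fintype.card W ≤ Fintype.card V + k := by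
  induction k generalizing V with
  | zero => exact ⟨V, inferInstance, G, id, h, .id G, le_rfl⟩
  | succ k ih =>
    rcases h with h | ⟨u, G', hsplit, h⟩
    · exact ⟨V, inferInstance, G, id, h, .id G, Nat.le_add_right _ _⟩
    · obtain ⟨W, hW, H, f, hP, hf, hcard⟩ := ih h
      refine ⟨W, hW, H, _, hP, hsplit.isFolding.comp hf, ?_⟩
      rw [Fintype.card_option] at hcard
      omega

theorem ExclReach.inclReach {P : (W : Type) → SimpleGraph W → Prop} {k : ℕ} {V : Type}
    {G : SimpleGraph V} (h : ExclReach P k V G) : InclReach P k V G := by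
  induction k generalizing V with
  | zero => exact h
  | succ k ih =>
    rcases h with h | ⟨u, G', hsplit, h⟩
    · exact Or.inl h
    · exact Or.inr ⟨u, G', hsplit.1, ih h⟩

/-- Every edge of the codomain has at most one preimage. -/
def EdgeInjective {W V : Type} (H : SimpleGraph W) (f : W → V) : Prop :=
  ∀ ⦃a b c d⦄, H.Adj a b → H.Adj c d → f a = f c → f b = f d → a = c ∧ b = d

theorem IsFolding.exists_isExclusiveSplit {W V : Type} {H : SimpleGraph W} {G : SimpleGraph V}
    {f : W → V} (hf : IsFolding H G f) (hinj : EdgeInjective H f) {w₁ w₂ : W}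
    (heq : f w₁ = f w₂) (hne : w₁ ≠ w₂) :
    ∃ (G' : SimpleGraph (Option V)) (g : W → Option V),
      IsExclusiveSplit G G' (f w₂) ∧ IsFolding H G' g ∧ EdgeInjective H g := by
  classical
  let g : W → Option V := fun w => if w = w₂ then none else some (f w)
  have h_getD : ∀ w, (g w).getD (f w₂) = f w := by
    intro w
    by_cases hw : w = w₂ <;> simp [g, hw]
  have h_none : ∀ w, g w = none ↔ w = w₂ := by
    intro w
    by_cases hw : w = w₂ <;> simp [g, hw]
  have h_some : ∀ w x, g w = some x ↔ w ≠ w₂ ∧ f w = x := by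
    intro w x
    by_cases hw : w = w₂ <;> simp [g, hw]
  let G' : SimpleGraph (Option V) :=
    { Adj := fun x y => ∃ a b, H.Adj a b ∧ g a = x ∧ g b = y
      symm := ⟨fun _ _ ⟨a, b, hab, ha, hb⟩ => ⟨b, a, hab.symm, hb, ha⟩⟩
      loopless := ⟨by
        rintro x ⟨a, b, hab, ha, hb⟩
        apply (hf.map_adj hab).ne
        rw [← h_getD a, ← h_getD b, ha, hb]⟩ }
  have h_adj : ∀ {x y}, G'.Adj x y → G.Adj (x.getD (f w₂)) (y.getD (f w₂)) := by
    rintro x y ⟨a, b, hab, rfl, rfl⟩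
    rw [h_getD, h_getD]
    exact hf.map_adj hab
  refine ⟨G', g, ⟨⟨?_, ?_, fun x h => h_adj h, fun x h => h_adj h, ?_⟩, ?_⟩,
    ⟨?_, fun h => ⟨_, _, h, rfl, rfl⟩, fun h => h⟩, ?_⟩
  · intro x y hx hy
    refine ⟨fun h => h_adj h, fun h => ?_⟩
    obtain ⟨a, b, hab, rfl, rfl⟩ := hf.exists_adj h
    exact ⟨a, b, hab, (h_some _ _).2 ⟨fun h => hx (h ▸ rfl), rfl⟩,
      (h_some _ _).2 ⟨fun h => hy (h ▸ rfl), rfl⟩⟩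
  · intro h
    exact (h_adj h).ne rfl
  · intro x h
    obtain ⟨a, b, hab, ha, rfl⟩ := hf.exists_adj h
    have hb : g b = some (f b) := (h_some _ _).2 ⟨fun hb => h.ne (hb ▸ rfl), rfl⟩
    by_cases haw : a = w₂
    · exact Or.inr ⟨a, b, hab, (h_none a).2 haw, hb⟩
    · exact Or.inl ⟨a, b, hab, (h_some _ _).2 ⟨haw, ha⟩, hb⟩
  · rintro x ⟨⟨a, b, hab, ha, hb⟩, ⟨c, d, hcd, hc, hd⟩⟩
    rw [h_some] at ha hb hd
    rw [h_none] at hc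
    subst hc
    exact ha.1 (hinj hab hcd ha.2 (hb.2.trans hd.2.symm)).1
  · rintro (_ | x)
    · exact ⟨w₂, (h_none _).2 rfl⟩
    · obtain ⟨w, rfl⟩ := hf.surjective x
      by_cases hw : w = w₂
      · exact ⟨w₁, (h_some _ _).2 ⟨hne, hw ▸ heq⟩⟩
      · exact ⟨w, (h_some _ _).2 ⟨hw, rfl⟩⟩
  · intro a b c d hab hcd hac hbd
    refine hinj hab hcd ?_ ?_
    · rw [← h_getD a, hac, h_getD]
    · rw [← h_getD b, hbd, h_getD]

/-- An injective folding is an isomorphism. -/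
noncomputable def IsFolding.iso {W V : Type} {H : SimpleGraph W} {G : SimpleGraph V}
    {f : W → V} (hf : IsFolding H G f) (hinj : Function.Injective f) : H ≃g G where
  toEquiv := Equiv.ofBijective f ⟨hinj, hf.surjective⟩
  map_rel_iff' := by
    intro a b
    refine ⟨fun h => ?_, fun h => hf.map_adj h⟩
    obtain ⟨c, d, hcd, hc, hd⟩ := hf.exists_adj h
    rwa [hinj hc, hinj hd] at hcd

theorem IsFolding.exclReach {P : (W : Type) → SimpleGraph W → Prop}
    (hP : ∀ {W W' : Type} {H : SimpleGraph W} {H' : SimpleGraph W'}, H ≃g H' → P W H → P W' H')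
    {k : ℕ} {W V : Type} [Fintype W] [Fintype V] {H : SimpleGraph W} {G : SimpleGraph V}
    {f : W → V} (hf : IsFolding H G f) (hinj : EdgeInjective H f) (hH : P W H)
    (hcard : Fintype.card W ≤ Fintype.card V + k) : ExclReach P k V G := by
  induction k generalizing V with
  | zero =>
    have hbij := (Fintype.bijective_iff_surjective_and_card f).2
      ⟨hf.surjective, hcard.antisymm (Fintype.card_le_of_surjective f hf.surjective)⟩
    exact hP (hf.iso hbij.1) hH
  | succ k ih =>
    by_cases hf_inj : Function.Injective f
    · exact Or.inl (hP (hf.iso hf_inj) hH)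
    · obtain ⟨w₁, w₂, heq, hne⟩ := Function.not_injective_iff.1 hf_inj
      obtain ⟨G', g, hsplit, hg, hg_inj⟩ := hf.exists_isExclusiveSplit hinj heq hne
      refine Or.inr ⟨_, G', hsplit, ih hg hg_inj ?_⟩
      rw [Fintype.card_option]
      omega

theorem IsLinearForest.of_iso {W W' : Type} {H : SimpleGraph W} {H' : SimpleGraph W'}
    (e : H ≃g H') (h : IsLinearForest H) : IsLinearForest H' := by
  refine ⟨h.1.comap e.symm.toHom e.symm.injective, fun v => ?_, fun v => ?_⟩
  · rw [← Set.ncard_image_of_injective _ e.symm.injective]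
    convert h.2.1 (e.symm v) using 2
    ext w
    constructor
    · rintro ⟨x, hx, rfl⟩
      exact e.symm.map_adj_iff.2 hx
    · intro hw
      refine ⟨e w, ?_, e.symm_apply_apply w⟩
      rw [mem_neighborSet, ← e.symm.map_adj_iff]
      simpa using hw
  · obtain ⟨w, hw⟩ := h.2.2 (e.symm v)
    refine ⟨e w, ?_⟩
    rw [← e.symm.map_adj_iff]
    simpa using hw

/-- Keeping one preimage of every edge and discarding the vertices that become isolated turns a
folding of a linear forest into an edge-injective one. -/
theorem IsFolding.exists_edgeInjective {W V : Type} [Fintype W] {H : SimpleGraph W}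
    {G : SimpleGraph V} {f : W → V} (hf : IsFolding H G f) (hH : IsLinearForest H) :
    ∃ s : Set W, ∃ K : SimpleGraph s, IsLinearForest K ∧
      IsFolding K G (fun w => f w) ∧ EdgeInjective K (fun w => f w) := by
  have h_edge : ∀ e : Sym2 V, ∃ e' : Sym2 W, e ∈ G.edgeSet → e' ∈ H.edgeSet ∧ e'.map f = e := by
    intro e
    by_cases he : e ∈ G.edgeSet
    · induction e with
      | _ x y =>
        obtain ⟨a, b, hab, rfl, rfl⟩ := hf.exists_adj he
        exact ⟨s(a, b), fun _ => ⟨hab, rfl⟩⟩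
    · obtain ⟨w⟩ : Nonempty (Sym2 W) := by
        induction e with
        | _ x y => exact ⟨s((hf.surjective x).choose, (hf.surjective x).choose)⟩
      exact ⟨w, fun h => (he h).elim⟩
  choose r hr using h_edge
  let L : SimpleGraph W :=
    { Adj := fun a b => H.Adj a b ∧ r s(f a, f b) = s(a, b)
      symm := ⟨fun a b ⟨hab, h⟩ => ⟨hab.symm, by rw [Sym2.eq_swap, h, Sym2.eq_swap]⟩⟩
      loopless := ⟨fun a h => H.irrefl h.1⟩ }
  have h_lift : ∀ {x y}, G.Adj x y → ∃ a b, L.Adj a b ∧ f a = x ∧ f b = y := by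
    intro x y hxy
    obtain ⟨h_mem, h_map⟩ := hr s(x, y) hxy
    generalize hab : r s(x, y) = e at h_mem h_map
    induction e with
    | _ a b =>
      have hL : L.Adj a b := ⟨h_mem, by rw [← Sym2.map_mk, h_map, hab]⟩
      rcases Sym2.eq_iff.1 h_map with ⟨ha, hb⟩ | ⟨ha, hb⟩
      · exact ⟨a, b, hL, ha, hb⟩
      · exact ⟨b, a, hL.symm, hb, ha⟩
  refine ⟨{w | ∃ w', L.Adj w w'}, L.induce _, ⟨?_, ?_, ?_⟩, ⟨?_, fun h => hf.map_adj h.1, ?_⟩, ?_⟩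
  · exact (hH.1.anti (show L ≤ H from fun _ _ h => h.1)).induce _
  · intro v
    rw [← Set.ncard_image_of_injective _ Subtype.val_injective]
    refine (Set.ncard_le_ncard ?_ (Set.toFinite _)).trans (hH.2.1 v)
    rintro _ ⟨x, hx, rfl⟩
    exact hx.1
  · rintro ⟨v, w, hvw⟩
    exact ⟨⟨w, v, hvw.symm⟩, hvw⟩
  · intro x
    obtain ⟨a, rfl⟩ := hf.surjective x
    obtain ⟨b, hab⟩ := hH.2.2 a
    obtain ⟨c, d, hcd, hc, -⟩ := h_lift (hf.map_adj hab)
    exact ⟨⟨c, d, hcd⟩, hc⟩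
  · intro x y hxy
    obtain ⟨a, b, hab, ha, hb⟩ := h_lift hxy
    exact ⟨⟨a, b, hab⟩, ⟨b, a, hab.symm⟩, hab, ha, hb⟩
  · rintro ⟨a, _⟩ ⟨b, _⟩ ⟨c, _⟩ ⟨d, _⟩ hab hcd hac hbd
    have h_same : s(a, b) = s(c, d) := by
      dsimp only at hac hbd
      have h_ab : r s(f a, f b) = s(a, b) := hab.2
      have h_cd : r s(f c, f d) = s(c, d) := hcd.2
      rw [← h_ab, ← h_cd, hac, hbd]
    rcases Sym2.eq_iff.1 h_same with ⟨rfl, rfl⟩ | ⟨rfl, rfl⟩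
    · exact ⟨rfl, rfl⟩
    · exact ((hf.map_adj hab.1).ne hac).elim

theorem InclReach.exclReach_linearForest {k : ℕ} {V : Type} [Fintype V] {G : SimpleGraph V}
    (h : InclReach (fun _ H => IsLinearForest H) k V G) :
    ExclReach (fun _ H => IsLinearForest H) k V G := by
  classical
  obtain ⟨W, _, H, f, hH, hf, hcard⟩ := h.exists_isFolding
  obtain ⟨s, K, hK, hfK, hinj⟩ := hf.exists_edgeInjective hH
  exact hfK.exclReach (P := fun _ H => IsLinearForest H) IsLinearForest.of_iso hinj hK
    ((set_fintype_card_le_univ s).trans hcard)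

/-- For every finite simple graph `G` that can be transformed into a
linear forest by vertex splits, the minimum number of exclusive vertex splits required
to transform `G` into a linear forest equals the minimum number of inclusive vertex
splits required. -/
theorem minExclusive_eq_minInclusive_linearForest {V : Type} [Fintype V]
    (G : SimpleGraph V)
    (h : ∃ k : ℕ, InclReach (fun _ H => IsLinearForest H) k V G) :
    sInf {k : ℕ | ExclReach (fun _ H => IsLinearForest H) k V G}
      = sInf {k : ℕ | InclReach (fun _ H => IsLinearForest H) k V G} := by
  congr 1
  ext k
  exact ⟨ExclReach.inclReach, InclReach.exclReach_linearForest⟩
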